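/- arXiv:1908.02519 — 7 statements merged into one kernel-verified Lean document; each statement's English description precedes it below -/
import Mathlib

section
/- Let α ∈ ℝ, b ∈ ℝ, let γ : ℝ → ℝ be differentiable with γ(t) ≤ b for all t, let e : ℝ × ℝ → ℝ be twice continuously differentiable and let g : ℝ × ℝ → ℝ be continuous. Suppose ∂t e(z,t) = α ∂z² e(z,t) + g(z,t) for all (z,t) ∈ ℝ × ℝ and that e(γ(t), t) = 0 for all t. Define V(t) := (1/2) ∫_{γ(t)}^{b} e(z,t)² dz. Then V is differentiable and for every t: V'(t) = α e(b,t) ∂z e(b,t) − α ∫_{γ(t)}^{b} (∂z e(z,t))² dz + ∫_{γ(t)}^{b} e(z,t) g(z,t) dz. -/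
theorem aux_bdry (f : ℝ → ℝ → ℝ) (hf : Continuous (Function.uncurry f)) (γ : ℝ → ℝ)
    (t₀ : ℝ) (hγ : DifferentiableAt ℝ γ t₀) (h0 : f (γ t₀) t₀ = 0) :
    HasDerivAt (fun t => ∫ z in (γ t₀)..(γ t), f z t) 0 t₀ := by
  rw [hasDerivAt_iff_isLittleO]
  simp only [intervalIntegral.integral_same, sub_zero, smul_zero]
  refine Asymptotics.IsLittleO.trans_isBigO (g := fun t => γ t - γ t₀) ?_ hγ.isBigO_sub
  rw [Asymptotics.isLittleO_iff]
  intro c hc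
  have h1 := Metric.continuousAt_iff.1 (hf.continuousAt (x := (γ t₀, t₀))) c hc
  obtain ⟨δ, hδ, h1⟩ := h1
  have h2 := hγ.continuousAt.eventually (Metric.ball_mem_nhds (γ t₀) hδ)
  filter_upwards [h2, Metric.ball_mem_nhds t₀ hδ] with t ht1 ht2
  rw [Real.norm_eq_abs (γ t - γ t₀)]
  refine intervalIntegral.norm_integral_le_of_norm_le_const ?_
  intro z hz
  have hzb : z ∈ Metric.ball (γ t₀) δ := by
    have hc : Set.OrdConnected (Metric.ball (γ t₀) δ) := (convex_ball _ _).ordConnected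
    exact hc.uIcc_subset (Metric.mem_ball_self hδ) ht1 (Set.uIoc_subset_uIcc hz)
  have h3 := @h1 (z, t) (by
    rw [Prod.dist_eq]; exact max_lt hzb ht2)
  simp only [Function.uncurry, h0, dist_zero_right] at h3
  exact h3.le

theorem aux_param (f f' : ℝ → ℝ → ℝ) (hf : Continuous (Function.uncurry f))
    (hf' : Continuous (Function.uncurry f'))
    (hd : ∀ z t, HasDerivAt (fun s => f z s) (f' z t) t) (a b t₀ : ℝ) :
    HasDerivAt (fun t => ∫ z in a..b, f z t) (∫ z in a..b, f' z t₀) t₀ := by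
  obtain ⟨C, hC⟩ := ((isCompact_uIcc (a := a) (b := b)).prod
    (isCompact_closedBall t₀ 1)).exists_bound_of_continuousOn hf'.continuousOn
  have c1 : ∀ t, Continuous (fun z => f z t) := fun t =>
    hf.comp (by fun_prop : Continuous fun z : ℝ => (z, t))
  have c2 : ∀ t, Continuous (fun z => f' z t) := fun t =>
    hf'.comp (by fun_prop : Continuous fun z : ℝ => (z, t))
  refine (intervalIntegral.hasDerivAt_integral_of_dominated_loc_of_deriv_le
    (F := fun t z => f z t) (F' := fun t z => f' z t) (bound := fun _ => C)
    (Metric.closedBall_mem_nhds t₀ one_pos) ?_ ?_ ?_ ?_ ?_ ?_).2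
  · exact Filter.Eventually.of_forall fun t => (c1 t).aestronglyMeasurable
  · exact (c1 t₀).intervalIntegrable _ _
  · exact (c2 t₀).aestronglyMeasurable
  · exact Filter.Eventually.of_forall fun z hz t ht =>
      hC (z, t) ⟨Set.uIoc_subset_uIcc hz, ht⟩
  · exact intervalIntegrable_const
  · exact Filter.Eventually.of_forall fun z _ t _ => hd z t

theorem aux_z (f : ℝ → ℝ → ℝ) (hf : Differentiable ℝ (Function.uncurry f)) (z t : ℝ) :
    HasDerivAt (fun z => f z t) (fderiv ℝ (Function.uncurry f) (z, t) (1, 0)) z :=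
  HasFDerivAt.comp_hasDerivAt (l := Function.uncurry f) (f := fun z => (z, t)) z
    (hf (z, t)).hasFDerivAt ((hasDerivAt_id z).prodMk (hasDerivAt_const z t))

theorem aux_t (f : ℝ → ℝ → ℝ) (hf : Differentiable ℝ (Function.uncurry f)) (z t : ℝ) :
    HasDerivAt (fun t => f z t) (fderiv ℝ (Function.uncurry f) (z, t) (0, 1)) t :=
  HasFDerivAt.comp_hasDerivAt (l := Function.uncurry f) (f := fun t => (z, t)) t
    (hf (z, t)).hasFDerivAt ((hasDerivAt_const t z).prodMk (hasDerivAt_id t))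

/-- Derivative of the Lyapunov functional
`V(t) = (1/2) ∫_{γ(t)}^{b} e(z,t)² dz` on the liquid domain (moving lower
boundary), where `e` satisfies `∂t e = α ∂z² e + g` and `e(γ(t),t) = 0`. -/
theorem stmt_3
    (α b : ℝ) (γ : ℝ → ℝ) (hγ : Differentiable ℝ γ)
    (hγb : ∀ t, γ t ≤ b)
    (e : ℝ → ℝ → ℝ) (he : ContDiff ℝ 2 (Function.uncurry e))
    (g : ℝ → ℝ → ℝ) (hg : Continuous (Function.uncurry g))
    (heat : ∀ z t, deriv (fun s => e z s) t
      = α * deriv (fun z' => deriv (fun z'' => e z'' t) z') z + g z t)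
    (hbnd : ∀ t, e (γ t) t = 0)
    (V : ℝ → ℝ)
    (hV : ∀ t, V t = (1/2) * ∫ z in (γ t)..b, (e z t)^2) :
    Differentiable ℝ V ∧ ∀ t, deriv V t
      = α * e b t * deriv (fun z => e z t) b
        - α * (∫ z in (γ t)..b, (deriv (fun z' => e z' t) z)^2)
        + ∫ z in (γ t)..b, e z t * g z t := by
  have hed : Differentiable ℝ (Function.uncurry e) := he.differentiable (by norm_num)
  have hec := hed.continuous
  have hF : ContDiff ℝ 1 (fderiv ℝ (Function.uncurry e)) := he.fderiv_right (by norm_num)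
  obtain ⟨ez, hez⟩ : ∃ ez : ℝ → ℝ → ℝ, ez = fun z t =>
    fderiv ℝ (Function.uncurry e) (z, t) (1, 0) := ⟨_, rfl⟩
  obtain ⟨et, het⟩ : ∃ et : ℝ → ℝ → ℝ, et = fun z t =>
    fderiv ℝ (Function.uncurry e) (z, t) (0, 1) := ⟨_, rfl⟩
  have hezC : ContDiff ℝ 1 (Function.uncurry ez) := by
    rw [hez]; exact hF.clm_apply contDiff_const
  have hetC : Continuous (Function.uncurry et) := by
    rw [het]; exact (hF.clm_apply contDiff_const).continuous
  have hezd : Differentiable ℝ (Function.uncurry ez) := hezC.differentiable (by norm_num)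
  obtain ⟨ezz, hezz⟩ : ∃ ezz : ℝ → ℝ → ℝ, ezz = fun z t =>
    fderiv ℝ (Function.uncurry ez) (z, t) (1, 0) := ⟨_, rfl⟩
  have hezzC : Continuous (Function.uncurry ezz) := by
    rw [hezz]; exact (hezC.continuous_fderiv (by norm_num)).clm_apply continuous_const
  have d1 : ∀ z t, HasDerivAt (fun z => e z t) (ez z t) z := by
    intro z t; rw [hez]; exact aux_z e hed z t
  have d2 : ∀ z t, HasDerivAt (fun t => e z t) (et z t) t := by
    intro z t; rw [het]; exact aux_t e hed z t
  have d3 : ∀ z t, HasDerivAt (fun z => ez z t) (ezz z t) z := by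
    intro z t; rw [hezz]; exact aux_z ez hezd z t
  have heat' : ∀ z t, et z t = α * ezz z t + g z t := by
    intro z t
    have := heat z t
    simp only [(d1 _ _).deriv, (d2 _ _).deriv, (d3 _ _).deriv] at this
    exact this
  simp only [(d1 _ _).deriv]
  have sl : ∀ f : ℝ → ℝ → ℝ, Continuous (Function.uncurry f) → ∀ t,
      Continuous (fun z => f z t) := fun f hf t =>
    hf.comp (by fun_prop : Continuous fun z : ℝ => (z, t))
  have ce := sl e hec
  have cez := sl ez hezC.continuous
  have cezz := sl ezz hezzC
  have cg := sl g hg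
  have key : ∀ t, HasDerivAt V (α * e b t * ez b t - α * (∫ z in (γ t)..b, (ez z t)^2)
      + ∫ z in (γ t)..b, e z t * g z t) t := by
    intro t₀
    have hsq : Continuous (Function.uncurry fun z t => (e z t)^2) := hec.pow 2
    have hc2 : Continuous (Function.uncurry fun z t => 2 * (e z t * et z t)) := by
      have : Continuous fun p : ℝ × ℝ =>
        (2:ℝ) * (Function.uncurry e p * Function.uncurry et p) := by fun_prop
      exact this
    have A := aux_param (fun z t => (e z t)^2) (fun z t => 2 * (e z t * et z t)) hsq
      hc2
      (fun z t => by
        have := (d2 z t).pow 2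
        refine HasDerivAt.congr_deriv this ?_
        norm_num
        ring) (γ t₀) b t₀
    have B := aux_bdry (fun z t => (e z t)^2) hsq γ t₀ (hγ t₀) (by simp [hbnd])
    have hVeq : V = fun t => (1/2) * ((∫ z in (γ t₀)..b, (e z t)^2)
        - ∫ z in (γ t₀)..(γ t), (e z t)^2) := by
      funext t
      rw [hV t, intervalIntegral.integral_interval_sub_left]
      · exact ((ce t).pow 2).intervalIntegrable _ _
      · exact ((ce t).pow 2).intervalIntegrable _ _
    have D := (A.sub B).const_mul (1/2 : ℝ)
    rw [hVeq]
    refine HasDerivAt.congr_deriv D ?_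
    have ibp := intervalIntegral.integral_mul_deriv_eq_deriv_mul
      (a := γ t₀) (b := b) (fun z _ => d1 z t₀) (fun z _ => d3 z t₀)
      ((cez t₀).intervalIntegrable _ _) ((cezz t₀).intervalIntegrable _ _)
    have split : (∫ z in (γ t₀)..b, e z t₀ * et z t₀)
        = α * (∫ z in (γ t₀)..b, e z t₀ * ezz z t₀) + ∫ z in (γ t₀)..b, e z t₀ * g z t₀ := by
      rw [← intervalIntegral.integral_const_mul, ← intervalIntegral.integral_add]
      · refine intervalIntegral.integral_congr fun z _ => ?_
        simp only [heat']; ring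
      · exact (continuous_const.mul ((ce t₀).mul (cezz t₀))).intervalIntegrable _ _
      · exact ((ce t₀).mul (cg t₀)).intervalIntegrable _ _
    rw [intervalIntegral.integral_const_mul, split, ibp, hbnd]
    simp only [pow_two]
    ring
  exact ⟨fun t => (key t).differentiableAt, fun t => (key t).deriv⟩
end

section
/- Let α ∈ ℝ, a ∈ ℝ, let γ : ℝ → ℝ be differentiable with a ≤ γ(t) for all t, let e : ℝ × ℝ → ℝ be twice continuously differentiable and let g : ℝ × ℝ → ℝ be continuous. Suppose ∂t e(z,t) = α ∂z² e(z,t) + g(z,t) for all (z,t) ∈ ℝ × ℝ and that e(γ(t), t) = 0 for all t. Define V(t) := (1/2) ∫_{a}^{γ(t)} e(z,t)² dz. Then V is differentiable and for every t: V'(t) = −α e(a,t) ∂z e(a,t) − α ∫_{a}^{γ(t)} (∂z e(z,t))² dz + ∫_{a}^{γ(t)} e(z,t) g(z,t) dz. -/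
open Filter Topology MeasureTheory intervalIntegral in
theorem aux_leibniz (f f' : ℝ → ℝ → ℝ) (hf : Continuous (Function.uncurry f))
    (hf' : Continuous (Function.uncurry f')) (hd : ∀ z t, HasDerivAt (fun s => f z s) (f' z t) t)
    (a b t : ℝ) : HasDerivAt (fun s => ∫ z in a..b, f z s) (∫ z in a..b, f' z t) t := by
  obtain ⟨C, hC⟩ := ((isCompact_uIcc (a := a) (b := b)).prod
    (isCompact_closedBall t 1)).exists_bound_of_continuousOn hf'.continuousOn
  have hc : ∀ s, Continuous (fun z => f z s) := fun s => by
    exact hf.comp (by fun_prop : Continuous fun z : ℝ => (z, s))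
  have hc' : ∀ s, Continuous (fun z => f' z s) := fun s => by
    exact hf'.comp (by fun_prop : Continuous fun z : ℝ => (z, s))
  refine (intervalIntegral.hasDerivAt_integral_of_dominated_loc_of_deriv_le (F := fun s z => f z s)
    (F' := fun s z => f' z s) (bound := fun _ => C)
    (Metric.ball_mem_nhds t one_pos) ?_ ?_ ?_ ?_ ?_ ?_).2
  · exact Eventually.of_forall fun s => (hc s).aestronglyMeasurable
  · exact (hc t).intervalIntegrable _ _
  · exact (hc' t).aestronglyMeasurable
  · exact Eventually.of_forall fun z hz s hs =>
      hC (z, s) ⟨Set.uIoc_subset_uIcc hz, Metric.ball_subset_closedBall hs⟩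
  · exact intervalIntegrable_const
  · exact Eventually.of_forall fun z _ s _ => hd z s

open Filter Topology MeasureTheory intervalIntegral in
theorem aux_moving (f : ℝ → ℝ → ℝ) (hf : Continuous (Function.uncurry f)) (γ : ℝ → ℝ) (t : ℝ)
    (hγ : DifferentiableAt ℝ γ t) (h0 : f (γ t) t = 0) :
    HasDerivAt (fun s => ∫ z in (γ t)..(γ s), f z s) 0 t := by
  rw [hasDerivAt_iff_isLittleO]
  have hO : (fun s => γ s - γ t) =O[𝓝 t] fun s => s - t := hγ.isBigO_sub
  refine Asymptotics.IsLittleO.trans_isBigO ?_ hO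
  rw [Asymptotics.isLittleO_iff]
  intro c hc
  have h1 : ∀ᶠ p in 𝓝 (γ t, t), |Function.uncurry f p| < c := by
    refine (hf.abs.tendsto (γ t, t)).eventually_lt_const ?_
    simpa [h0] using hc
  obtain ⟨δ, hδ, hb⟩ := Metric.eventually_nhds_iff.1 h1
  have h2 : ∀ᶠ s in 𝓝 t, dist (γ s) (γ t) < δ :=
    hγ.continuousAt.eventually (Metric.ball_mem_nhds _ hδ)
  filter_upwards [h2, Metric.ball_mem_nhds t hδ] with s hs hs'
  simp only [integral_same, smul_zero, sub_zero]
  refine norm_integral_le_of_norm_le_const fun z hz => ?_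
  refine (hb (y := (z, s)) ?_).le
  rw [Prod.dist_eq]
  refine max_lt (lt_of_le_of_lt ?_ hs) hs'
  have := Set.abs_sub_left_of_mem_uIcc (Set.uIoc_subset_uIcc hz)
  simpa [Real.dist_eq] using this

open Filter Topology MeasureTheory intervalIntegral in
theorem stmt_4
    (α a : ℝ) (γ : ℝ → ℝ) (hγ : Differentiable ℝ γ)
    (haγ : ∀ t, a ≤ γ t)
    (e : ℝ → ℝ → ℝ) (he : ContDiff ℝ 2 (Function.uncurry e))
    (g : ℝ → ℝ → ℝ) (hg : Continuous (Function.uncurry g))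
    (heat : ∀ z t, deriv (fun s => e z s) t
      = α * deriv (fun z' => deriv (fun z'' => e z'' t) z') z + g z t)
    (hbnd : ∀ t, e (γ t) t = 0)
    (V : ℝ → ℝ)
    (hV : ∀ t, V t = (1/2) * ∫ z in a..(γ t), (e z t)^2) :
    Differentiable ℝ V ∧ ∀ t, deriv V t
      = -(α * e a t * deriv (fun z => e z t) a)
        - α * (∫ z in a..(γ t), (deriv (fun z' => e z' t) z)^2)
        + ∫ z in a..(γ t), e z t * g z t := by
  have hdt : ∀ z t, HasDerivAt (fun s => e z s) (fderiv ℝ (Function.uncurry e) (z, t) (0, 1)) t := by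
    intro z t
    exact ((he.differentiable (by norm_num)) (z, t)).hasFDerivAt.comp_hasDerivAt t
      ((hasDerivAt_const t z).prodMk (hasDerivAt_id t))
  have hF : Continuous (fderiv ℝ (Function.uncurry e)) := he.continuous_fderiv (by norm_num)
  have hec : Continuous (Function.uncurry e) := he.continuous
  have het : Continuous fun p : ℝ × ℝ => deriv (fun s => e p.1 s) p.2 := by
    simp only [fun z t => (hdt z t).deriv]
    fun_prop
  have hs : ∀ t, ContDiff ℝ 2 (fun z => e z t) := fun t =>
    he.comp (by fun_prop : ContDiff ℝ 2 fun z : ℝ => (z, t))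
  have hs1 : ∀ t, ContDiff ℝ 1 (deriv (fun z => e z t)) := fun t =>
    ((contDiff_succ_iff_deriv (n := 1)).1 (by simpa [one_add_one_eq_two] using hs t)).2.2
  have key : ∀ t, HasDerivAt V (-(α * e a t * deriv (fun z => e z t) a)
        - α * (∫ z in a..(γ t), (deriv (fun z' => e z' t) z)^2)
        + ∫ z in a..(γ t), e z t * g z t) t := by
    intro t
    have hsq : Continuous (Function.uncurry fun z t => (e z t)^2) := hec.pow 2
    have hcc : Continuous (Function.uncurry fun z t => 2 * (e z t * deriv (fun s => e z s) t)) := by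
      have h := (hec.mul het).const_mul 2
      exact h
    have h1 := aux_leibniz (fun z t => (e z t)^2) (fun z t => 2 * (e z t * deriv (fun s => e z s) t))
      hsq hcc (fun z t => by
        have := (hdt z t).differentiableAt.hasDerivAt.pow 2
        refine this.congr_deriv ?_
        norm_num
        ring) a (γ t) t
    have h2 := aux_moving (fun z t => (e z t)^2) hsq γ t (hγ t) (by simp [hbnd])
    have h3 := (h1.add h2).const_mul (1/2)
    have hVeq : V = fun s => (1/2) * ((∫ z in a..(γ t), (e z s)^2) + ∫ z in (γ t)..(γ s), (e z s)^2) := by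
      funext s
      have hc : Continuous fun z => (e z s)^2 := (hs s).continuous.pow 2
      rw [hV, integral_add_adjacent_intervals (hc.intervalIntegrable _ _) (hc.intervalIntegrable _ _)]
    rw [hVeq]
    refine h3.congr_deriv ?_
    have c0 := (hs t).continuous
    have c1 := (hs1 t).continuous
    have c2 : Continuous (deriv (deriv (fun z => e z t))) := (hs1 t).continuous_deriv (by norm_num)
    have cg : Continuous fun z => g z t := hg.comp (by fun_prop : Continuous fun z : ℝ => (z, t))
    have ibp := integral_mul_deriv_eq_deriv_mul (a := a) (b := γ t)
      (u := fun z => e z t) (v := deriv (fun z => e z t))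
      (u' := deriv (fun z => e z t)) (v' := deriv (deriv (fun z => e z t)))
      (fun z _ => ((hs t).differentiable (by norm_num) z).hasDerivAt)
      (fun z _ => ((hs1 t).differentiable (by norm_num) z).hasDerivAt)
      (c1.intervalIntegrable _ _) (c2.intervalIntegrable _ _)
    have e1 : (∫ z in a..(γ t), 2 * (e z t * deriv (fun s => e z s) t)) =
        2 * (α * (∫ z in a..(γ t), e z t * deriv (deriv (fun z => e z t)) z)
          + ∫ z in a..(γ t), e z t * g z t) := by
      have i1 : Continuous fun z => α * (e z t * deriv (deriv (fun z => e z t)) z) := by fun_prop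
      have i2 : Continuous fun z => e z t * g z t := by fun_prop
      rw [intervalIntegral.integral_const_mul, ← intervalIntegral.integral_const_mul α,
        ← intervalIntegral.integral_add
        (i1.intervalIntegrable _ _)
        (i2.intervalIntegrable _ _)]
      congr 1
      refine integral_congr fun z _ => ?_
      simp only [heat]
      ring
    rw [e1, ibp, hbnd]
    simp only [← pow_two]
    ring
  exact ⟨fun t => (key t).differentiableAt, fun t => (key t).deriv⟩
end

section
/- Let 0 ≤ a ≤ b ≤ L be real numbers and let e : ℝ → ℝ be continuously differentiable on [a,b] with e(a) = 0. Then (1/2) ∫_a^b e(z)² dz ≤ b · e(b)² + 2 L² ∫_a^b (e'(z))² dz. -/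
/-- Modified Poincaré-type inequality for a function vanishing at
the left endpoint: `(1/2) ∫_a^b e² ≤ b e(b)² + 2L² ∫_a^b (e')²`. -/
theorem stmt_5
    (a b L : ℝ) (ha : 0 ≤ a) (hab : a ≤ b) (hbL : b ≤ L)
    (e : ℝ → ℝ) (he : ContDiffOn ℝ 1 e (Set.Icc a b))
    (hea : e a = 0) :
    (1/2) * (∫ z in a..b, (e z)^2)
      ≤ b * (e b)^2 + 2 * L^2 * ∫ z in a..b, (deriv e z)^2 := by
  rcases hab.eq_or_lt with h | hlt
  · subst h
    simp [hea]
  set g := derivWithin e (Set.Icc a b) with hg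
  have hgc : ContinuousOn g (Set.Icc a b) :=
    he.continuousOn_derivWithin (uniqueDiffOn_Icc hlt) le_rfl
  have hec := he.continuousOn
  have hd : ∀ x ∈ Set.Ioo a b, HasDerivAt e (g x) x := fun x hx =>
    ((he.differentiableOn one_ne_zero x (Set.Ioo_subset_Icc_self hx)).hasDerivWithinAt).hasDerivAt
      (Icc_mem_nhds hx.1 hx.2)
  have hcong : ∫ z in a..b, (deriv e z)^2 = ∫ z in a..b, (g z)^2 := by
    rw [intervalIntegral.integral_of_le hab, intervalIntegral.integral_of_le hab,
      MeasureTheory.integral_Ioc_eq_integral_Ioo, MeasureTheory.integral_Ioc_eq_integral_Ioo]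
    refine MeasureTheory.setIntegral_congr_fun measurableSet_Ioo fun x hx => ?_
    simp only [(hd x hx).deriv]
  have hFc : ContinuousOn (fun z => (e z)^2 + 2 * z * e z * g z) (Set.Icc a b) := by fun_prop
  have hFi := hFc.intervalIntegrable_of_Icc (μ := MeasureTheory.volume) hab
  have hGc : ContinuousOn (fun z => 2 * L^2 * (g z)^2) (Set.Icc a b) := by fun_prop
  have hGi := hGc.intervalIntegrable_of_Icc (μ := MeasureTheory.volume) hab
  have hEc : ContinuousOn (fun z => (1/2) * (e z)^2) (Set.Icc a b) := by fun_prop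
  have hEi := hEc.intervalIntegrable_of_Icc (μ := MeasureTheory.volume) hab
  have hftc := intervalIntegral.integral_eq_sub_of_hasDerivAt_of_le hab
    (f := fun z => z * (e z)^2) (f' := fun z => (e z)^2 + 2 * z * e z * g z)
    (by fun_prop) (fun x hx => by
      refine ((hasDerivAt_id' x).mul ((hd x hx).pow 2)).congr_deriv ?_
      simp
      ring) hFi
  have hm := intervalIntegral.integral_mono_on hab hEi (hFi.add hGi) (fun z hz => by
    have h1 : z^2 ≤ L^2 := pow_le_pow_left₀ (ha.trans hz.1) (hz.2.trans hbL) 2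
    have h2 := mul_nonneg (sub_nonneg.2 h1) (sq_nonneg (g z))
    nlinarith [sq_nonneg (e z + 2 * z * g z)])
  rw [intervalIntegral.integral_add hFi hGi, hftc, intervalIntegral.integral_const_mul,
    intervalIntegral.integral_const_mul, hea] at hm
  rw [hcong]
  linarith
end

section
/- Let 0 ≤ a ≤ b ≤ L be real numbers and let e : ℝ → ℝ be continuously differentiable on [a,b] with e(b) = 0. Then (1/2) ∫_a^b e(z)² dz + a · e(a)² ≤ 2 L² ∫_a^b (e'(z))² dz. -/
/-- Modified Poincaré-type inequality for a function vanishing at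
the right endpoint: `(1/2) ∫_a^b e² + a e(a)² ≤ 2L² ∫_a^b (e')²`. -/
theorem stmt_6
    (a b L : ℝ) (ha : 0 ≤ a) (hab : a ≤ b) (hbL : b ≤ L)
    (e : ℝ → ℝ) (he : ContDiffOn ℝ 1 e (Set.Icc a b))
    (heb : e b = 0) :
    (1/2) * (∫ z in a..b, (e z)^2) + a * (e a)^2
      ≤ 2 * L^2 * ∫ z in a..b, (deriv e z)^2 := by
  rcases hab.eq_or_lt with h | hlt
  · subst h
    simp [heb]
  set g := derivWithin e (Set.Icc a b) with hg
  have hgc : ContinuousOn g (Set.Icc a b) :=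
    he.continuousOn_derivWithin (uniqueDiffOn_Icc hlt) le_rfl
  have hec : ContinuousOn e (Set.Icc a b) := he.continuousOn
  have hd : ∀ x ∈ Set.Ioo a b, HasDerivAt e (g x) x := fun x hx =>
    ((he.differentiableOn one_ne_zero x
      (Set.Ioo_subset_Icc_self hx)).hasDerivWithinAt).hasDerivAt (Icc_mem_nhds hx.1 hx.2)
  have hint : ∫ z in a..b, (deriv e z)^2 = ∫ z in a..b, (g z)^2 := by
    rw [intervalIntegral.integral_of_le hab, intervalIntegral.integral_of_le hab,
      MeasureTheory.integral_Ioc_eq_integral_Ioo, MeasureTheory.integral_Ioc_eq_integral_Ioo]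
    refine MeasureTheory.setIntegral_congr_fun measurableSet_Ioo fun x hx => ?_
    simp only [(hd x hx).deriv]
  rw [hint]
  have i1 : IntervalIntegrable (fun z => (e z)^2) MeasureTheory.volume a b :=
    ContinuousOn.intervalIntegrable_of_Icc hab (by fun_prop)
  have i2 : IntervalIntegrable (fun z => (g z)^2) MeasureTheory.volume a b :=
    ContinuousOn.intervalIntegrable_of_Icc hab (by fun_prop)
  have i3 : IntervalIntegrable (fun z => (e z)^2 + z * (2 * e z * g z))
      MeasureTheory.volume a b :=
    ContinuousOn.intervalIntegrable_of_Icc hab (by fun_prop)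
  have ftc : ∫ z in a..b, ((e z)^2 + z * (2 * e z * g z)) = b * (e b)^2 - a * (e a)^2 := by
    refine intervalIntegral.integral_eq_sub_of_hasDerivAt_of_le (f := fun z => z * (e z)^2) hab
      (by fun_prop) (fun x hx => ?_) i3
    have := (hasDerivAt_id x).mul ((hd x hx).pow 2)
    refine HasDerivAt.congr_deriv (f := fun z => z * (e z)^2) this ?_
    simp
  have key : ∫ z in a..b, ((1/2) * (e z)^2 - 2 * L^2 * (g z)^2)
      ≤ ∫ z in a..b, ((e z)^2 + z * (2 * e z * g z)) := by
    refine intervalIntegral.integral_mono_on hab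
      ((i1.const_mul _).sub (i2.const_mul _)) i3 fun x hx => ?_
    have hx0 : 0 ≤ x := ha.trans hx.1
    have hxL : x^2 ≤ L^2 := pow_le_pow_left₀ hx0 (hx.2.trans hbL) 2
    nlinarith [sq_nonneg (e x + 2 * x * g x), mul_le_mul_of_nonneg_right hxL (sq_nonneg (g x))]
  rw [ftc, intervalIntegral.integral_sub (i1.const_mul _) (i2.const_mul _),
    intervalIntegral.integral_const_mul, intervalIntegral.integral_const_mul, heb] at key
  linarith
end

section
/- Let Γ_l > 0, α_s > 0, α_l > 0, κ_s ≥ 0 and κ_l ≥ 1/(2Γ_l). Let γ : ℝ → ℝ be differentiable with 0 < γ(t) < Γ_l for all t, and let e_s, e_l : ℝ × ℝ → ℝ be twice continuously differentiable with: (i) ∂t e_s(z,t) = α_s ∂z² e_s(z,t) and ∂t e_l(z,t) = α_l ∂z² e_l(z,t) for all (z,t) ∈ ℝ × ℝ; (ii) e_s(γ(t),t) = 0 and e_l(γ(t),t) = 0 for all t (zero error at the phase boundary); (iii) the closed-loop boundary conditions ∂z e_s(0,t) = κ_s e_s(0,t) and ∂z e_l(Γ_l,t) = −κ_l e_l(Γ_l,t)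 for all t. Define V(t) := (1/2) ∫_0^{γ(t)} e_s(z,t)² dz + (1/2) ∫_{γ(t)}^{Γ_l} e_l(z,t)² dz and set C := min(α_s, α_l)/(2Γ_l²). Then V is differentiable and for all t: V'(t) ≤ −α_s κ_s e_s(0,t)² − α_l (κ_l − 1/(2Γ_l)) e_l(Γ_l,t)² − C · V(t). -/
open MeasureTheory Filter Topology Set in
theorem leib_aux (F Ft : ℝ → ℝ → ℝ) (hF : Continuous (Function.uncurry F))
    (hFt : Continuous (Function.uncurry Ft))
    (hd : ∀ z t, HasDerivAt (fun s => F z s) (Ft z t) t)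
    (γ : ℝ → ℝ) (c t0 : ℝ) (hγ : DifferentiableAt ℝ γ t0) (h0 : F (γ t0) t0 = 0) :
    HasDerivAt (fun t => ∫ z in c..γ t, F z t) (∫ z in c..γ t0, Ft z t0) t0 := by
  have hFz : ∀ t, Continuous (fun z => F z t) := fun t =>
    hF.comp (by fun_prop : Continuous (fun z : ℝ => (z, t)))
  have hFtz : ∀ t, Continuous (fun z => Ft z t) := fun t =>
    hFt.comp (by fun_prop : Continuous (fun z : ℝ => (z, t)))
  have h1 : HasDerivAt (fun t => ∫ z in c..γ t0, F z t) (∫ z in c..γ t0, Ft z t0) t0 := by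
    obtain ⟨M, hM⟩ := ((isCompact_uIcc (a := c) (b := γ t0)).prod
      (isCompact_Icc (a := t0 - 1) (b := t0 + 1))).exists_bound_of_continuousOn hFt.continuousOn
    refine (intervalIntegral.hasDerivAt_integral_of_dominated_loc_of_deriv_le
      (F := fun t z => F z t) (F' := fun t z => Ft z t) (bound := fun _ => M)
      (s := Icc (t0 - 1) (t0 + 1)) (Icc_mem_nhds (by linarith) (by linarith)) ?_ ?_ ?_ ?_ ?_ ?_).2
    · exact Eventually.of_forall fun t => (hFz t).aestronglyMeasurable
    · exact (hFz t0).intervalIntegrable _ _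
    · exact (hFtz t0).aestronglyMeasurable
    · exact Eventually.of_forall fun z hz t ht => hM (z, t) ⟨uIoc_subset_uIcc hz, ht⟩
    · exact intervalIntegrable_const
    · exact Eventually.of_forall fun z hz t ht => hd z t
  have h2 : HasDerivAt (fun t => ∫ z in γ t0..γ t, F z t) 0 t0 := by
    rw [hasDerivAt_iff_isLittleO]
    simp only [intervalIntegral.integral_same, sub_zero, smul_zero]
    have hO : (fun t => γ t - γ t0) =O[𝓝 t0] (fun t => t - t0) := hγ.hasDerivAt.isBigO_sub
    refine Asymptotics.IsLittleO.trans_isBigO ?_ hO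
    rw [Asymptotics.isLittleO_iff]
    intro ε hε
    have hc : ContinuousAt (Function.uncurry F) (γ t0, t0) := hF.continuousAt
    obtain ⟨δ, hδ, hb⟩ := Metric.continuousAt_iff.1 hc ε hε
    have e1 : ∀ᶠ t in 𝓝 t0, dist (γ t) (γ t0) < δ :=
      hγ.continuousAt.eventually (Metric.ball_mem_nhds _ hδ)
    have e2 : ∀ᶠ t in 𝓝 t0, dist t t0 < δ := Metric.ball_mem_nhds _ hδ
    filter_upwards [e1, e2] with t ht1 ht2
    refine intervalIntegral.norm_integral_le_of_norm_le_const fun z hz => ?_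
    have hz' : dist z (γ t0) < δ := by
      refine lt_of_le_of_lt ?_ ht1
      rw [Real.dist_eq, Real.dist_eq]
      exact abs_sub_left_of_mem_uIcc (uIoc_subset_uIcc hz)
    have := hb (x := (z, t)) (by rw [Prod.dist_eq]; exact max_lt hz' ht2)
    simp only [Function.uncurry, h0, dist_zero_right] at this
    exact this.le
  have h3 := h1.add h2
  rw [add_zero] at h3
  refine h3.congr_of_eventuallyEq (Eventually.of_forall fun t => ?_)
  exact (intervalIntegral.integral_add_adjacent_intervals
    ((hFz t).intervalIntegrable _ _) ((hFz t).intervalIntegrable _ _)).symm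

theorem poinc_aux (f f' : ℝ → ℝ) (hf : ∀ z, HasDerivAt f (f' z) z) (hf' : Continuous f')
    (a b c L : ℝ) (hab : a ≤ b) (ha : (a - c) * f a ^ 2 = 0) (hb : (b - c) * f b ^ 2 = 0)
    (hL : ∀ z ∈ Set.Icc a b, (z - c) ^ 2 ≤ L ^ 2) :
    ∫ z in a..b, f z ^ 2 ≤ 4 * L ^ 2 * ∫ z in a..b, f' z ^ 2 := by
  have hfc : Continuous f := continuous_iff_continuousAt.2 fun z => (hf z).continuousAt
  have key : ∫ z in a..b, (f z ^ 2 + (z - c) * (2 * f z * f' z)) = 0 := by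
    rw [intervalIntegral.integral_eq_sub_of_hasDerivAt (f := fun z => (z - c) * f z ^ 2)]
    · rw [ha, hb, sub_zero]
    · intro z _
      have := ((hasDerivAt_id z).sub_const c).mul ((hf z).pow 2)
      refine this.congr_deriv ?_
      simp
    · exact Continuous.intervalIntegrable (by fun_prop) _ _
  have mono : ∫ z in a..b, (2⁻¹ * f z ^ 2 - 2 * L ^ 2 * f' z ^ 2) ≤
      ∫ z in a..b, (f z ^ 2 + (z - c) * (2 * f z * f' z)) := by
    refine intervalIntegral.integral_mono_on hab
      (Continuous.intervalIntegrable (by fun_prop) _ _)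
      (Continuous.intervalIntegrable (by fun_prop) _ _) fun z hz => ?_
    nlinarith [sq_nonneg (f z + 2 * (z - c) * f' z),
      mul_le_mul_of_nonneg_right (hL z hz) (sq_nonneg (f' z))]
  rw [key, intervalIntegral.integral_sub (Continuous.intervalIntegrable (by fun_prop) _ _)
    (Continuous.intervalIntegrable (by fun_prop) _ _), intervalIntegral.integral_const_mul,
    intervalIntegral.integral_const_mul] at mono
  linarith

theorem energy_aux (e : ℝ → ℝ → ℝ) (α c : ℝ) (hα : 0 < α)
    (he : ContDiff ℝ 2 (Function.uncurry e))
    (heat : ∀ z t, deriv (fun s => e z s) t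
      = α * deriv (fun z' => deriv (fun z'' => e z'' t) z') z)
    (γ : ℝ → ℝ) (hγ : Differentiable ℝ γ) (hb : ∀ t, e (γ t) t = 0) (t : ℝ) :
    (∀ z, HasDerivAt (fun z => e z t) (deriv (fun z => e z t) z) z) ∧
    Continuous (deriv (fun z => e z t)) ∧
    HasDerivAt (fun t => ∫ z in c..γ t, e z t ^ 2)
      (2 * (-(α * e c t * deriv (fun z => e z t) c)
        - α * ∫ z in c..γ t, deriv (fun z => e z t) z ^ 2)) t := by
  have hdiff : Differentiable ℝ (Function.uncurry e) := he.differentiable (by norm_num)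
  have hec : Continuous (Function.uncurry e) := he.continuous
  have hfd : ContDiff ℝ 1 (fderiv ℝ (Function.uncurry e)) := he.fderiv_right (by norm_num)
  have dt : ∀ z t, HasDerivAt (fun s => e z s)
      (fderiv ℝ (Function.uncurry e) (z, t) (0, 1)) t := fun z t =>
    (hdiff (z, t)).hasFDerivAt.comp_hasDerivAt (f := fun s => (z, s)) t
      ((hasDerivAt_const t z).prodMk (hasDerivAt_id t))
  have dz : ∀ z t, HasDerivAt (fun z => e z t)
      (fderiv ℝ (Function.uncurry e) (z, t) (1, 0)) z := fun z t =>
    (hdiff (z, t)).hasFDerivAt.comp_hasDerivAt (f := fun z => (z, t)) z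
      ((hasDerivAt_id z).prodMk (hasDerivAt_const z t))
  have ct : Continuous (fun p : ℝ × ℝ => fderiv ℝ (Function.uncurry e) p (0, 1)) :=
    hfd.continuous.clm_apply continuous_const
  have cz : ContDiff ℝ 1 (fun z : ℝ => fderiv ℝ (Function.uncurry e) (z, t) (1, 0)) :=
    (hfd.comp (contDiff_id.prodMk contDiff_const)).clm_apply contDiff_const
  have hdz : deriv (fun z => e z t)
      = fun z : ℝ => fderiv ℝ (Function.uncurry e) (z, t) (1, 0) :=
    funext fun z => (dz z t).deriv
  have cz' : ContDiff ℝ 1 (deriv (fun z => e z t)) := hdz ▸ cz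
  have A : ∀ z, HasDerivAt (fun z => e z t) (deriv (fun z => e z t) z) z :=
    fun z => (dz z t).differentiableAt.hasDerivAt
  have B := cz'.continuous
  refine ⟨A, B, ?_⟩
  have ezc : Continuous (fun z => e z t) := hec.comp (by fun_prop : Continuous (fun z : ℝ => (z, t)))
  have hsq : Continuous (Function.uncurry fun z t => e z t ^ 2) := by
    have h : Continuous (fun p : ℝ × ℝ => Function.uncurry e p ^ 2) := by fun_prop
    exact h
  have hsq2 : Continuous (Function.uncurry fun z t =>
      2 * e z t * fderiv ℝ (Function.uncurry e) (z, t) (0, 1)) := by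
    have h : Continuous (fun p : ℝ × ℝ =>
      2 * Function.uncurry e p * fderiv ℝ (Function.uncurry e) p (0, 1)) :=
      (continuous_const.mul hec).mul ct
    exact h
  have L := leib_aux (fun z t => e z t ^ 2)
    (fun z t => 2 * e z t * fderiv ℝ (Function.uncurry e) (z, t) (0, 1))
    hsq hsq2
    (fun z t => ((dt z t).fun_pow 2).congr_deriv (by simp)) γ c t (hγ t) (by simp [hb])
  refine L.congr_deriv ?_
  have hdd : ∀ z, HasDerivAt (deriv (fun z => e z t)) (deriv (deriv (fun z => e z t)) z) z :=
    fun z => (cz'.differentiable (by norm_num) z).hasDerivAt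
  have cdd : Continuous (deriv (deriv (fun z => e z t))) := cz'.continuous_deriv (by norm_num)
  have ibp := intervalIntegral.integral_mul_deriv_eq_deriv_mul
    (a := c) (b := γ t) (u := fun z => e z t)
    (fun z _ => A z) (fun z _ => hdd z) (B.intervalIntegrable _ _) (cdd.intervalIntegrable _ _)
  have : ∀ z, 2 * e z t * fderiv ℝ (Function.uncurry e) (z, t) (0, 1)
      = 2 * α * (e z t * deriv (deriv (fun z => e z t)) z) := fun z => by
    rw [← (dt z t).deriv, heat]; ring
  simp only [this, intervalIntegral.integral_const_mul, ibp, hb]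
  simp only [← pow_two]
  ring


/-- Lyapunov decrease estimate for the closed-loop two-phase
Stefan problem with spatially constant reference profile:
`V'(t) ≤ -α_s κ_s e_s(0,t)² - α_l (κ_l - 1/(2Γ_l)) e_l(Γ_l,t)² - C V(t)`
with `C = min(α_s, α_l)/(2Γ_l²)`. -/
theorem stmt_7
    (Γl αs αl κs κl : ℝ)
    (hΓl : 0 < Γl) (hαs : 0 < αs) (hαl : 0 < αl)
    (hκs : 0 ≤ κs) (hκl : 1 / (2 * Γl) ≤ κl)
    (γ : ℝ → ℝ) (hγ : Differentiable ℝ γ)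
    (hγ0 : ∀ t, 0 < γ t) (hγΓ : ∀ t, γ t < Γl)
    (es el : ℝ → ℝ → ℝ)
    (hes : ContDiff ℝ 2 (Function.uncurry es))
    (hel : ContDiff ℝ 2 (Function.uncurry el))
    (heats : ∀ z t, deriv (fun s => es z s) t
      = αs * deriv (fun z' => deriv (fun z'' => es z'' t) z') z)
    (heatl : ∀ z t, deriv (fun s => el z s) t
      = αl * deriv (fun z' => deriv (fun z'' => el z'' t) z') z)
    (hbs : ∀ t, es (γ t) t = 0) (hbl : ∀ t, el (γ t) t = 0)
    (hrobs : ∀ t, deriv (fun z => es z t) 0 = κs * es 0 t)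
    (hrobl : ∀ t, deriv (fun z => el z t) Γl = -(κl * el Γl t))
    (V : ℝ → ℝ)
    (hV : ∀ t, V t = (1/2) * (∫ z in (0:ℝ)..(γ t), (es z t)^2)
      + (1/2) * ∫ z in (γ t)..Γl, (el z t)^2)
    (C : ℝ) (hC : C = min αs αl / (2 * Γl^2)) :
    Differentiable ℝ V ∧ ∀ t, deriv V t
      ≤ -(αs * κs * (es 0 t)^2)
        - αl * (κl - 1 / (2 * Γl)) * (el Γl t)^2
        - C * V t := by
  have Es := fun t => energy_aux es αs 0 hαs hes heats γ hγ hbs t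
  have El := fun t => energy_aux el αl Γl hαl hel heatl γ hγ hbl t
  have hD : ∀ t, HasDerivAt V ((-(αs * es 0 t * deriv (fun z => es z t) 0)
        - αs * ∫ z in (0:ℝ)..γ t, deriv (fun z => es z t) z ^ 2)
      + ((αl * el Γl t * deriv (fun z => el z t) Γl)
        - αl * ∫ z in γ t..Γl, deriv (fun z => el z t) z ^ 2)) t := by
    intro t
    have h := ((Es t).2.2.const_mul (1/2)).sub ((El t).2.2.const_mul (1/2))
    have hVe : V = fun t => (1/2) * (∫ z in (0:ℝ)..(γ t), (es z t)^2)
      - (1/2) * ∫ z in Γl..(γ t), (el z t)^2 := by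
      funext t
      rw [hV, intervalIntegral.integral_symm Γl (γ t)]; ring
    rw [hVe]
    refine h.congr_deriv ?_
    rw [intervalIntegral.integral_symm (γ t) Γl]; ring
  refine ⟨fun t => (hD t).differentiableAt, fun t => ?_⟩
  rw [(hD t).deriv, hrobs, hrobl, hV t]
  have P1 := poinc_aux (fun z => es z t) _ (Es t).1 (Es t).2.1 0 (γ t) 0 Γl (hγ0 t).le
    (by simp) (by simp [hbs]) (fun z hz => by
      have := hγΓ t
      have h1 := hz.1
      have h2 := hz.2
      exact sq_le_sq' (by linarith) (by linarith))
  have P2 := poinc_aux (fun z => el z t) _ (El t).1 (El t).2.1 (γ t) Γl Γl Γl (hγΓ t).le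
    (by simp [hbl]) (by simp) (fun z hz => by
      have := hγ0 t
      have h1 := hz.1
      have h2 := hz.2
      exact sq_le_sq' (by linarith) (by linarith))
  have N1 : 0 ≤ ∫ z in (0:ℝ)..γ t, deriv (fun z => es z t) z ^ 2 :=
    intervalIntegral.integral_nonneg (hγ0 t).le fun z _ => sq_nonneg _
  have N2 : 0 ≤ ∫ z in γ t..Γl, deriv (fun z => el z t) z ^ 2 :=
    intervalIntegral.integral_nonneg (hγΓ t).le fun z _ => sq_nonneg _
  have hm : 0 < min αs αl := lt_min hαs hαl
  have hC0 : 0 < C := by rw [hC]; positivity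
  have hC2 : C * (2 * Γl ^ 2) = min αs αl := by rw [hC]; field_simp
  have Q1 := mul_le_mul_of_nonneg_left P1 hC0.le
  have Q2 := mul_le_mul_of_nonneg_left P2 hC0.le
  have R1 := mul_le_mul_of_nonneg_right (min_le_left αs αl) N1
  have R2 := mul_le_mul_of_nonneg_right (min_le_right αs αl) N2
  rw [← hC2] at R1 R2
  have S : 0 ≤ αl * (1 / (2 * Γl)) * el Γl t ^ 2 := by positivity
  linarith
end

section
/- Let C, K > 0, ν > 0 and T > 0. Let V : ℝ → ℝ be differentiable with V(t) ≥ ν² for all t ∈ [0,T], and let g : ℝ → ℝ be continuous satisfying V'(t) ≤ −C · V(t) + K · |g(t)| · √(V(t)) for all t ∈ [0,T]. If moreover ∫_0^t |g(s)| ds ≤ (C ν / K) · t for all t ∈ [0,T], then V(t) ≤ V(0) for all t ∈ [0,T]. -/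
/-- Decrease criterion: under the Gronwall-type bound of the
Lyapunov analysis, if the total variation `∫_0^t |g|` grows at most linearly
with slope `Cν/K`, then `V(t) ≤ V(0)` on `[0,T]`. -/
theorem stmt_11
    (C K ν T : ℝ) (hC : 0 < C) (hK : 0 < K) (hν : 0 < ν) (hT : 0 < T)
    (V : ℝ → ℝ) (hV : Differentiable ℝ V)
    (hVν : ∀ t ∈ Set.Icc (0:ℝ) T, ν^2 ≤ V t)
    (g : ℝ → ℝ) (hg : Continuous g)
    (hineq : ∀ t ∈ Set.Icc (0:ℝ) T,
      deriv V t ≤ -C * V t + K * |g t| * Real.sqrt (V t))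
    (hvar : ∀ t ∈ Set.Icc (0:ℝ) T,
      (∫ s in (0:ℝ)..t, |g s|) ≤ (C * ν / K) * t) :
    ∀ t ∈ Set.Icc (0:ℝ) T, V t ≤ V 0 := by
  have hI : ∀ t, HasDerivAt (fun t => ∫ s in (0:ℝ)..t, |g s|) (|g t|) t := fun t =>
    intervalIntegral.integral_hasDerivAt_right (hg.abs.intervalIntegrable _ _)
      (hg.abs.stronglyMeasurableAtFilter _ _) hg.abs.continuousAt
  have hW : ∀ t, HasDerivAt
      (fun t => V t * Real.exp (C * t - K / ν * ∫ s in (0:ℝ)..t, |g s|))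
      (deriv V t * Real.exp (C * t - K / ν * ∫ s in (0:ℝ)..t, |g s|) +
        V t * (Real.exp (C * t - K / ν * ∫ s in (0:ℝ)..t, |g s|) *
          (C * 1 - K / ν * |g t|))) t := fun t =>
    (hV t).hasDerivAt.mul
      ((((hasDerivAt_id t).const_mul C).sub ((hI t).const_mul (K / ν))).exp)
  have hanti : AntitoneOn
      (fun t => V t * Real.exp (C * t - K / ν * ∫ s in (0:ℝ)..t, |g s|)) (Set.Icc 0 T) := by
    apply antitoneOn_of_deriv_nonpos (convex_Icc 0 T)
    · exact fun t _ => (hW t).continuousAt.continuousWithinAt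
    · exact fun t _ => (hW t).differentiableAt.differentiableWithinAt
    · intro t ht
      have ht := interior_subset ht
      rw [(hW t).deriv]
      have h1 := hineq t ht
      have h2 := hVν t ht
      have h3 : ν ≤ Real.sqrt (V t) := Real.le_sqrt_of_sq_le h2
      have h4 : Real.sqrt (V t) * Real.sqrt (V t) = V t :=
        Real.mul_self_sqrt ((sq_nonneg ν).trans h2)
      have h5 : Real.sqrt (V t) ≤ V t / ν := by
        rw [le_div_iff₀ hν]
        nlinarith [Real.sqrt_nonneg (V t)]
      have h6 : K * |g t| * Real.sqrt (V t) ≤ K * |g t| * (V t / ν) :=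
        mul_le_mul_of_nonneg_left h5 (by positivity)
      have h7 : K * |g t| * (V t / ν) = V t * (K / ν * |g t|) := by ring
      have h8 : deriv V t + V t * (C * 1 - K / ν * |g t|) ≤ 0 := by linarith
      have h9 := mul_nonpos_of_nonpos_of_nonneg h8
        (Real.exp_pos (C * t - K / ν * ∫ s in (0:ℝ)..t, |g s|)).le
      linarith
  intro t ht
  have h := hanti (Set.left_mem_Icc.2 hT.le) ht ht.1
  simp only [intervalIntegral.integral_same, mul_zero, sub_zero, Real.exp_zero, mul_one] at h
  have hv := mul_le_mul_of_nonneg_left (hvar t ht) (by positivity : 0 ≤ K / ν)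
  have he : K / ν * (C * ν / K * t) = C * t := by field_simp
  have h1 : 1 ≤ Real.exp (C * t - K / ν * ∫ s in (0:ℝ)..t, |g s|) :=
    Real.one_le_exp (by linarith)
  have h0 : 0 ≤ V t := (sq_nonneg ν).trans (hVν t ht)
  exact (le_mul_of_one_le_right h0 h1).trans h
end

section
/- Let α ∈ ℝ with α ≠ 0, let v : ℝ → ℝ be continuous, and let f : ℝ × ℝ → ℝ be smooth (infinitely differentiable) and satisfy the convection–diffusion equation ∂t f(z,t) = α ∂z² f(z,t) + v(t) ∂z f(z,t) for all (z,t) ∈ ℝ × ℝ. For i ∈ ℕ define the coefficient functions c_i(t) := ∂z^i f(0,t) (the i-th iterated spatial derivative of f evaluated at z = 0). Then each c_i is differentiable and for all i ∈ ℕ and t ∈ ℝ: c_{i+2}(t) = (1/α) (c_i'(t) − v(t) · c_{i+1}(t)). -/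
lemma aux_D1 {g : ℝ → ℝ → ℝ} (hg : Differentiable ℝ (Function.uncurry g)) (z t : ℝ) :
    HasDerivAt (fun z' => g z' t) (fderiv ℝ (Function.uncurry g) (z, t) (1, 0)) z := by
  have h := (hg (z, t)).hasFDerivAt.comp_hasDerivAt z
    ((hasDerivAt_id z).prodMk (hasDerivAt_const z t))
  exact h

lemma aux_D2 {g : ℝ → ℝ → ℝ} (hg : Differentiable ℝ (Function.uncurry g)) (z t : ℝ) :
    HasDerivAt (fun s => g z s) (fderiv ℝ (Function.uncurry g) (z, t) (0, 1)) t := by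
  have h := (hg (z, t)).hasFDerivAt.comp_hasDerivAt t
    ((hasDerivAt_const t z).prodMk (hasDerivAt_id t))
  exact h

lemma aux_smooth {g : ℝ → ℝ → ℝ} (hg : ContDiff ℝ (⊤ : ℕ∞) (Function.uncurry g)) (w : ℝ × ℝ) :
    ContDiff ℝ (⊤ : ℕ∞)
      (Function.uncurry fun z t => fderiv ℝ (Function.uncurry g) (z, t) w) := by
  have h : ContDiff ℝ (⊤ : ℕ∞) (fderiv ℝ (Function.uncurry g)) := hg.fderiv_right (by simp)
  exact h.clm_apply contDiff_const

lemma aux_diff {g : ℝ → ℝ → ℝ} (hg : ContDiff ℝ (⊤ : ℕ∞) (Function.uncurry g)) :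
    Differentiable ℝ (Function.uncurry g) := hg.differentiable (by simp)

lemma aux_fd {g : ℝ → ℝ → ℝ} (hg : ContDiff ℝ (⊤ : ℕ∞) (Function.uncurry g)) (w u : ℝ × ℝ)
    (p : ℝ × ℝ) :
    fderiv ℝ (Function.uncurry fun z t => fderiv ℝ (Function.uncurry g) (z, t) w) p u
      = fderiv ℝ (fderiv ℝ (Function.uncurry g)) p u w := by
  have h : ContDiff ℝ (⊤ : ℕ∞) (fderiv ℝ (Function.uncurry g)) := hg.fderiv_right (by simp)
  have h2 := ((h.differentiable (by simp)) p).hasFDerivAt.clm_apply (hasFDerivAt_const w p)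
  have h3 : HasFDerivAt (Function.uncurry fun z t => fderiv ℝ (Function.uncurry g) (z, t) w) _ p :=
    h2
  rw [h3.fderiv]
  simp

lemma aux_swap {g : ℝ → ℝ → ℝ} (hg : ContDiff ℝ (⊤ : ℕ∞) (Function.uncurry g)) (z t : ℝ) :
    deriv (fun s => deriv (fun z' => g z' s) z) t
      = deriv (fun z' => deriv (fun s => g z' s) t) z := by
  have e1 : (fun s => deriv (fun z' => g z' s) z)
      = fun s => fderiv ℝ (Function.uncurry g) (z, s) (1, 0) :=
    funext fun s => (aux_D1 (aux_diff hg) z s).deriv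
  have e2 : (fun z' => deriv (fun s => g z' s) t)
      = fun z' => fderiv ℝ (Function.uncurry g) (z', t) (0, 1) :=
    funext fun s => (aux_D2 (aux_diff hg) s t).deriv
  rw [e1, e2, (aux_D2 (aux_diff (aux_smooth hg (1, 0))) z t).deriv,
    (aux_D1 (aux_diff (aux_smooth hg (0, 1))) z t).deriv, aux_fd hg, aux_fd hg]
  exact (hg.contDiffAt.isSymmSndFDerivAt (by simp only [minSmoothness_of_isRCLikeNormedField]; exact WithTop.coe_le_coe.2 (le_top : (2 : ℕ∞) ≤ ⊤))) _ _

lemma aux_smooth1 {g : ℝ → ℝ → ℝ} (hg : ContDiff ℝ (⊤ : ℕ∞) (Function.uncurry g)) :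
    ContDiff ℝ (⊤ : ℕ∞) (Function.uncurry fun z t => deriv (fun z' => g z' t) z) := by
  have e : (fun z t => deriv (fun z' => g z' t) z)
      = fun z t => fderiv ℝ (Function.uncurry g) (z, t) (1, 0) := by
    funext z t
    exact (aux_D1 (aux_diff hg) z t).deriv
  rw [e]
  exact aux_smooth hg _

lemma aux_main (α : ℝ) (hα : α ≠ 0) (v : ℝ → ℝ) (i : ℕ) :
    ∀ (f : ℝ → ℝ → ℝ) (_ : ContDiff ℝ (⊤ : ℕ∞) (Function.uncurry f))
    (_ : ∀ z t, deriv (fun s => f z s) t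
      = α * deriv (fun z' => deriv (fun z'' => f z'' t) z') z
        + v t * deriv (fun z' => f z' t) z),
    Differentiable ℝ (fun t => iteratedDeriv i (fun z => f z t) 0) ∧
    ∀ t, iteratedDeriv (i + 2) (fun z => f z t) 0 = (1 / α) *
      (deriv (fun t => iteratedDeriv i (fun z => f z t) 0) t
        - v t * iteratedDeriv (i + 1) (fun z => f z t) 0) := by
  induction i with
  | zero =>
    intro f hf heat
    simp only [iteratedDeriv_zero]
    refine ⟨fun t => (aux_D2 (aux_diff hf) 0 t).differentiableAt, fun t => ?_⟩
    rw [heat 0 t]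
    simp only [zero_add, iteratedDeriv_succ, iteratedDeriv_zero]
    field_simp
    ring
  | succ i ih =>
    intro f hf heat
    have h1 := aux_smooth1 hf
    have h2 := aux_smooth1 h1
    have key := ih (fun z t => deriv (fun z' => f z' t) z) h1 (by
      intro z t
      rw [aux_swap hf]
      simp only [heat]
      exact (((aux_D1 (aux_diff h2) z t).differentiableAt.hasDerivAt.const_mul α).add
        ((aux_D1 (aux_diff h1) z t).differentiableAt.hasDerivAt.const_mul (v t))).deriv)
    have e : ∀ n t, iteratedDeriv (n + 1) (fun z => f z t) 0
        = iteratedDeriv n (fun z => deriv (fun z' => f z' t) z) 0 := by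
      intro n t
      rw [iteratedDeriv_succ']
    rw [show i + 1 + 2 = (i + 2) + 1 by ring]
    simp only [e] at key ⊢
    exact key

/-- Recursion formula of the flatness-based power series
parametrisation: for a smooth solution of the convection–diffusion equation
`∂t f = α ∂z² f + v(t) ∂z f`, the coefficients `c_i(t) = ∂z^i f(0,t)` are
differentiable and satisfy `c_{i+2} = (1/α)(c_i' - v c_{i+1})`. -/
theorem stmt_12
    (α : ℝ) (hα : α ≠ 0) (v : ℝ → ℝ) (hv : Continuous v)
    (f : ℝ → ℝ → ℝ) (hf : ContDiff ℝ (⊤ : ℕ∞) (Function.uncurry f))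
    (heat : ∀ z t, deriv (fun s => f z s) t
      = α * deriv (fun z' => deriv (fun z'' => f z'' t) z') z
        + v t * deriv (fun z' => f z' t) z)
    (c : ℕ → ℝ → ℝ)
    (hc : ∀ i t, c i t = iteratedDeriv i (fun z => f z t) 0) :
    (∀ i, Differentiable ℝ (c i)) ∧
      ∀ i t, c (i + 2) t = (1 / α) * (deriv (c i) t - v t * c (i + 1) t) := by
  have e : ∀ i, c i = fun t => iteratedDeriv i (fun z => f z t) 0 := fun i => funext (hc i)
  refine ⟨fun i => ?_, fun i t => ?_⟩
  · rw [e]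
    exact (aux_main α hα v i f hf heat).1
  · simp only [e]
    exact (aux_main α hα v i f hf heat).2 t
end
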